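/- (Huneke's uniform Artin–Rees theorem, polynomial ring case) Let k be an algebraically closed field of characteristic zero and f ∈ k[x_1, …, x_n] a nonzero polynomial. Then there exists an integer k_0 ≥ 0, depending only on f, such that for every ideal 𝔟 ⊆ k[x_1,…,x_n] and every integer m ≥ k_0 one has 𝔟^m ∩ (f) ⊆ 𝔟^{m−k_0}·(f). -/

import Mathlib

open MvPolynomial

/-- The derivative of `((x + y) ^ p - x ^ p - y ^ p) / p`, for a prime `p = q + 1`. -/
theorem Derivation.exists_apply_eq_add_pow_sub {R A : Type*} [CommRing R] [CommRing A]
    [Algebra R A] (D : Derivation R A A) {q : ℕ} (hq : (q + 1).Prime) (x y : A) :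
    ∃ t, D t = ((x + y) ^ q - x ^ q) * D x + ((x + y) ^ q - y ^ q) * D y := by
  have hdvd : ∀ j ∈ Finset.range q, ∃ c, (q + 1).choose (j + 1) = (q + 1) * c := fun j hj ↦
    hq.dvd_choose_self (by simp) (by simpa using hj)
  choose! c hc using hdvd
  have hc₁ : ∀ j ∈ Finset.range q, c j * (j + 1) = q.choose j := fun j hj ↦ by
    have := Nat.add_one_mul_choose_eq q j
    rw [hc j hj] at this
    exact Nat.eq_of_mul_eq_mul_left q.succ_pos (by rw [Nat.succ_eq_add_one, this]; ring)
  have hc₂ : ∀ j ∈ Finset.range q, c j * (q - j) = q.choose (j + 1) := fun j hj ↦ by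
    have := Nat.choose_mul_succ_eq q (j + 1)
    rw [hc j hj, Nat.add_sub_add_right] at this
    exact Nat.eq_of_mul_eq_mul_left q.succ_pos
      (by rw [Nat.succ_eq_add_one, ← mul_assoc, ← this]; ring)
  refine ⟨∑ j ∈ Finset.range q, c j • (x ^ (j + 1) * y ^ (q - j)), ?_⟩
  have h₁ : (x + y) ^ q - x ^ q =
      ∑ j ∈ Finset.range q, x ^ j * y ^ (q - j) * (q.choose j : A) := by
    rw [add_pow, Finset.sum_range_succ]; simp
  have h₂ : (x + y) ^ q - y ^ q =
      ∑ j ∈ Finset.range q, x ^ (j + 1) * y ^ (q - (j + 1)) * (q.choose (j + 1) : A) := by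
    rw [add_pow, Finset.sum_range_succ']; simp
  rw [h₁, h₂, map_sum, Finset.sum_mul, Finset.sum_mul, ← Finset.sum_add_distrib]
  refine Finset.sum_congr rfl fun j hj ↦ ?_
  rw [← hc₁ j hj, ← hc₂ j hj, map_nsmul, D.leibniz, D.leibniz_pow, D.leibniz_pow]
  simp only [nsmul_eq_mul, smul_eq_mul, Nat.sub_sub, Nat.add_sub_cancel]
  push_cast
  ring

namespace MvPolynomial

variable {σ F : Type*} [Field F] (p : ℕ) [hp : Fact p.Prime] [CharP F p] [PerfectRing F p]

/-- The Cartier operator along the `i`-th coordinate, composed with the standard Frobenius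
splitting in the remaining coordinates. -/
noncomputable def cartier (i : σ) : MvPolynomial σ F →+ MvPolynomial σ F where
  toFun r := AddMonoidAlgebra.ofCoeff <| Finsupp.mapRange (frobeniusEquiv F p).symm (map_zero _)
    (Finsupp.comapDomain (fun α : σ →₀ ℕ ↦ p • α + Finsupp.single i (p - 1))
      (AddMonoidAlgebra.coeff r)
      (fun α _ β _ h ↦ by
        ext j
        have := DFunLike.congr_fun h j
        simpa [hp.out.ne_zero] using this))
  map_zero' := by
    ext
    change (frobeniusEquiv F p).symm 0 = 0
    simp
  map_add' r s := by
    ext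
    exact map_add (frobeniusEquiv F p).symm _ _

theorem coeff_cartier (i : σ) (r : MvPolynomial σ F) (α : σ →₀ ℕ) :
    coeff α (cartier p i r) =
      (frobeniusEquiv F p).symm (coeff (p • α + Finsupp.single i (p - 1)) r) :=
  rfl

theorem cartier_pow_mul (i : σ) (a r : MvPolynomial σ F) :
    cartier p i (a ^ p * r) = a * cartier p i r := by
  induction a using MvPolynomial.induction_on' with
  | add a b ha hb => rw [add_pow_char, add_mul, map_add, ha, hb, add_mul]
  | monomial β c =>
    ext α
    have hp0 := hp.out.pos
    have hle : p • β ≤ p • α + Finsupp.single i (p - 1) ↔ β ≤ α := by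
      classical
      simp only [Finsupp.le_def, Finsupp.add_apply, Finsupp.smul_apply, smul_eq_mul,
        Finsupp.single_apply]
      refine forall_congr' fun j ↦ ⟨fun h ↦ ?_, fun h ↦ ?_⟩
      · have : p * β j < p * (α j + 1) := by
          rw [mul_add]
          split_ifs at h <;> omega
        exact Nat.lt_succ_iff.mp (Nat.lt_of_mul_lt_mul_left this)
      · exact (Nat.mul_le_mul_left p h).trans (Nat.le_add_right _ _)
    rw [monomial_pow, coeff_cartier, coeff_monomial_mul', coeff_monomial_mul', coeff_cartier]
    by_cases h : β ≤ α
    · have hsub : p • α + Finsupp.single i (p - 1) - p • β =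
          p • (α - β) + Finsupp.single i (p - 1) := by
        obtain ⟨γ, rfl⟩ := exists_add_of_le h
        rw [smul_add, add_assoc, add_tsub_cancel_left, add_tsub_cancel_left]
      rw [if_pos (hle.mpr h), if_pos h, hsub, map_mul, frobeniusEquiv_symm_pow]
    · rw [if_neg (hle.not.mpr h), if_neg h, map_zero]

theorem cartier_pderiv (i : σ) (r : MvPolynomial σ F) : cartier p i (pderiv i r) = 0 := by
  ext α
  rw [coeff_cartier, coeff_pderiv]
  have : (((p • α + Finsupp.single i (p - 1)) i : ℕ) : F) + 1 = 0 := by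
    have h : (p • α + Finsupp.single i (p - 1)) i + 1 = p * (α i + 1) := by
      have := hp.out.pos
      simp only [Finsupp.add_apply, Finsupp.smul_apply, smul_eq_mul, Finsupp.single_eq_same]
      rw [mul_add]
      omega
    rw [← Nat.cast_add_one, h, Nat.cast_mul, CharP.cast_eq_zero, zero_mul]
  rw [this, mul_zero, map_zero, coeff_zero]

/-- The Cartier operator fixes logarithmic differentials. -/
theorem cartier_pow_mul_pderiv (i : σ) (f : MvPolynomial σ F) :
    cartier p i (f ^ (p - 1) * pderiv i f) = pderiv i f := by
  have hp1 : p - 1 + 1 = p := Nat.sub_add_cancel hp.out.one_le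
  induction f using MvPolynomial.induction_on' with
  | add f g hf hg =>
    obtain ⟨t, ht⟩ := (pderiv (R := F) i).exists_apply_eq_add_pow_sub
      (q := p - 1) (by rw [hp1]; exact hp.out) f g
    have : (f + g) ^ (p - 1) * pderiv i (f + g) =
        pderiv i t + f ^ (p - 1) * pderiv i f + g ^ (p - 1) * pderiv i g := by
      rw [ht, map_add]; ring
    rw [this, map_add, map_add, cartier_pderiv, hf, hg, zero_add, map_add]
  | monomial β c =>
    rw [monomial_pow, pderiv_monomial, monomial_mul]
    by_cases hβ : β i = 0
    · simp [hβ]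
    obtain ⟨γ, rfl⟩ : ∃ γ, β = γ + Finsupp.single i 1 :=
      ⟨β - Finsupp.single i 1,
        (tsub_add_cancel_of_le (by simpa using Nat.one_le_iff_ne_zero.mpr hβ)).symm⟩
    have he : (p - 1) • (γ + Finsupp.single i 1) + (γ + Finsupp.single i 1 - Finsupp.single i 1) =
        p • γ + Finsupp.single i (p - 1) := by
      rw [add_tsub_cancel_right, smul_add, Finsupp.smul_single, smul_eq_mul, mul_one]
      conv_rhs => rw [← hp1, add_smul, one_smul, hp1]
      abel
    rw [he, add_tsub_cancel_right]
    classical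
    ext α
    rw [coeff_cartier, coeff_monomial, coeff_monomial]
    by_cases h : γ = α
    · subst h
      rw [if_pos rfl, if_pos rfl, ← mul_assoc, ← pow_succ, hp1, map_mul, frobeniusEquiv_symm_pow,
        map_natCast]
    · have : ¬ p • γ + Finsupp.single i (p - 1) = p • α + Finsupp.single i (p - 1) := by
        intro h'
        apply h
        ext j
        have := DFunLike.congr_fun (add_right_cancel h') j
        simpa [hp.out.ne_zero] using this
      rw [if_neg this, if_neg h, map_zero]

theorem cartier_iterate_pow_mul (i : σ) (e : ℕ) (a r : MvPolynomial σ F) :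
    (cartier p i)^[e] (a ^ p ^ e * r) = a * (cartier p i)^[e] r := by
  induction e generalizing r with
  | zero => simp
  | succ e ih =>
    rw [Function.iterate_succ_apply, Function.iterate_succ_apply, pow_succ p e, pow_mul,
      cartier_pow_mul, ih]

theorem cartier_iterate_pow_mul_pderiv (i : σ) (e : ℕ) (f : MvPolynomial σ F) :
    (cartier p i)^[e] (f ^ (p ^ e - 1) * pderiv i f) = pderiv i f := by
  induction e with
  | zero => simp
  | succ e ih =>
    have h : p ^ (e + 1) - 1 = (p ^ e - 1) * p + (p - 1) := by
      have h₁ := hp.out.pos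
      have h₂ : 0 < p ^ e := pow_pos h₁ e
      have h₃ : p ≤ p ^ e * p := Nat.le_mul_of_pos_left p h₂
      rw [pow_succ, Nat.sub_mul, one_mul]
      omega
    rw [Function.iterate_succ_apply, h, pow_add, pow_mul, mul_assoc, cartier_pow_mul,
      cartier_pow_mul_pderiv, ih]

end MvPolynomial

theorem MvPolynomial.exists_isHomogeneous_aeval_eq_zero {F : Type*} [Field F] {n N : ℕ}
    (hN : n + 1 < N) (h : Fin N → MvPolynomial (Fin n) F) :
    ∃ (G : MvPolynomial (Fin N) F) (d : ℕ), G ≠ 0 ∧ G.IsHomogeneous d ∧ aeval h G = 0 := by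
  let t : Fin N → Polynomial (MvPolynomial (Fin n) F) := fun i ↦
    Polynomial.C (h i) * Polynomial.X
  have ht : ¬ AlgebraicIndependent F t := fun hind ↦ by
    have h₁ := (hind.map' (f := (finSuccEquiv F n).symm.toAlgHom)
      (finSuccEquiv F n).symm.injective).lift_cardinalMk_le_trdeg
    rw [MvPolynomial.trdeg_of_isDomain] at h₁
    simp only [Cardinal.mk_fin, Cardinal.lift_natCast, Nat.cast_le] at h₁
    omega
  rw [algebraicIndependent_iff] at ht
  push Not at ht
  obtain ⟨G, hG, hG0⟩ := ht
  obtain ⟨d, hd⟩ : ∃ d, homogeneousComponent d G ≠ 0 := by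
    by_contra! H
    exact hG0 (by rw [← sum_homogeneousComponent G]; simp [H])
  refine ⟨_, d, hd, homogeneousComponent_isHomogeneous d G, ?_⟩
  have key : ∀ e, aeval t (homogeneousComponent e G) =
      Polynomial.C (aeval h (homogeneousComponent e G)) * Polynomial.X ^ e := fun e ↦ by
    have he := homogeneousComponent_isHomogeneous e G
    conv_lhs => rw [(homogeneousComponent e G).as_sum]
    conv_rhs => rw [(homogeneousComponent e G).as_sum]
    rw [map_sum, map_sum, map_sum, Finset.sum_mul]
    refine Finset.sum_congr rfl fun α hα ↦ ?_
    have hdeg := he (mem_support_iff.mp hα)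
    rw [aeval_monomial, aeval_monomial, ← hdeg, map_mul]
    simp only [t, mul_pow, Finsupp.prod, Finset.prod_mul_distrib, Finset.prod_pow_eq_pow_sum,
      Finsupp.weight_apply, Finsupp.sum, Pi.one_apply, smul_eq_mul, mul_one, map_prod, map_pow]
    rw [← mul_assoc]
    rfl
  have hsum : ∑ e ∈ Finset.range (G.totalDegree + 1),
      Polynomial.C (aeval h (homogeneousComponent e G)) * Polynomial.X ^ e = 0 := by
    rw [← hG]
    conv_rhs => rw [← sum_homogeneousComponent G, map_sum]
    exact Finset.sum_congr rfl fun e _ ↦ (key e).symm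
  have := congr_arg (fun P ↦ P.coeff d) hsum
  simp only [Polynomial.finsetSum_coeff, Polynomial.coeff_C_mul, Polynomial.coeff_X_pow, mul_ite,
    mul_one,
    mul_zero, Finset.sum_ite_eq, Polynomial.coeff_zero] at this
  rwa [if_pos] at this
  rw [Finset.mem_range, Nat.lt_succ_iff]
  by_contra! H
  exact hd (homogeneousComponent_eq_zero d G H)

theorem MvPolynomial.IsHomogeneous.aeval_sub_aeval_mem {ι K R : Type*} [CommRing K] [CommRing R]
    [Algebra K R] {I J : Ideal R} {u v : ι → R} (hu : ∀ i, u i ∈ I) (hv : ∀ i, v i ∈ I)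
    (huv : ∀ i, u i - v i ∈ J) {d : ℕ} {G : MvPolynomial ι K} (hG : G.IsHomogeneous (d + 1)) :
    MvPolynomial.aeval u G - MvPolynomial.aeval v G ∈ J * I ^ d := by
  have key : ∀ (d : ℕ) (α : ι →₀ ℕ), α.degree = d + 1 →
      (α.prod fun i e ↦ u i ^ e) - (α.prod fun i e ↦ v i ^ e) ∈ J * I ^ d := by
    have hsplit : ∀ (d : ℕ) (α : ι →₀ ℕ), α.degree = d + 1 →
        ∃ i β, α = Finsupp.single i 1 + β ∧ β.degree = d := by
      intro d α hα
      obtain ⟨i, hi⟩ : ∃ i, α i ≠ 0 := by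
        by_contra! H
        have : α = 0 := Finsupp.ext H
        simp [this] at hα
      obtain ⟨β, rfl⟩ : ∃ β, α = Finsupp.single i 1 + β :=
        ⟨α - Finsupp.single i 1,
          (add_tsub_cancel_of_le (by simpa using Nat.one_le_iff_ne_zero.mpr hi)).symm⟩
      refine ⟨i, β, rfl, ?_⟩
      rw [map_add, Finsupp.degree_single] at hα
      omega
    intro d
    induction d with
    | zero =>
      intro α hα
      obtain ⟨i, β, rfl, hβ⟩ := hsplit 0 α hα
      rw [Finsupp.degree_eq_zero_iff] at hβ
      simpa [hβ] using huv i
    | succ d ih =>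
      intro α hα
      obtain ⟨i, β, rfl, hβ⟩ := hsplit (d + 1) α hα
      classical
      rw [Finsupp.prod_add_index' (by simp) (by simp [pow_add]),
        Finsupp.prod_add_index' (by simp) (by simp [pow_add])]
      simp only [pow_zero, Finsupp.prod_single_index, pow_one]
      have huI : (β.prod fun i e ↦ u i ^ e) ∈ I ^ (d + 1) := by
        rw [← hβ, Finsupp.degree_apply, ← Finset.prod_pow_eq_pow_sum]
        exact Ideal.prod_mem_prod fun j _ ↦ Ideal.pow_mem_pow (hu j) _
      have h₁ := Ideal.mul_mem_mul (huv i) huI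
      have h₂ := Ideal.mul_mem_mul (ih β hβ) (hv i)
      rw [mul_assoc, ← pow_succ] at h₂
      convert add_mem h₁ h₂ using 1
      ring
  rw [G.as_sum, map_sum, map_sum, ← Finset.sum_sub_distrib]
  refine Ideal.sum_mem _ fun α hα ↦ ?_
  rw [aeval_monomial, aeval_monomial, ← mul_sub]
  refine Ideal.mul_mem_left _ _ (key d α ?_)
  rw [← hG (mem_support_iff.mp hα), Finsupp.degree_eq_weight_one]
  rfl

theorem Ideal.sup_span_singleton_pow_succ_le {R : Type*} [CommRing R] (J : Ideal R) (y : R)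
    (e : ℕ) :
    (J ⊔ span {y}) ^ (e + 1) ≤ J * (J ⊔ span {y}) ^ e ⊔ span {y ^ (e + 1)} := by
  induction e with
  | zero => simp
  | succ e ih =>
    rw [pow_succ _ (e + 1)]
    refine (Ideal.mul_mono_left ih).trans ?_
    rw [Ideal.sup_mul, mul_assoc, ← pow_succ, Ideal.mul_sup]
    refine sup_le le_sup_left (sup_le ?_ ?_)
    · refine le_sup_of_le_left ?_
      rw [mul_comm]
      refine Ideal.mul_mono_right ((span_singleton_le_iff_mem _).mpr (pow_mem_pow ?_ _))
      exact mem_sup_right (mem_span_singleton_self y)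
    · rw [span_singleton_mul_span_singleton, ← pow_succ]
      exact le_sup_right

/-- An ideal spanned by more than `n + 1` polynomials in `n` variables over an infinite field has a
reduction spanned by one polynomial less. -/
theorem MvPolynomial.exists_reduction_succ {F : Type*} [Field F] [Infinite F] {n N : ℕ}
    (hN : n + 1 ≤ N) (h : Fin (N + 1) → MvPolynomial (Fin n) F) :
    ∃ (h' : Fin N → MvPolynomial (Fin n) F) (s : ℕ),
      Ideal.span (Set.range h') ≤ Ideal.span (Set.range h) ∧
      ∀ j, Ideal.span (Set.range h) ^ (j + s) ≤ Ideal.span (Set.range h') ^ j := by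
  obtain ⟨G₀, d, hG₀, hGd, hGh⟩ := exists_isHomogeneous_aeval_eq_zero (by omega) h
  set G := G₀ * X 0
  have hG : G.IsHomogeneous (d + 1) := hGd.mul (isHomogeneous_X _ _)
  have hG0 : G ≠ 0 := mul_ne_zero hG₀ (X_ne_zero _)
  obtain ⟨c, hc⟩ : ∃ c, eval c G ≠ 0 := by
    by_contra! H
    exact hG0 (MvPolynomial.funext fun x ↦ by simpa using H x)
  have hc0 : c 0 ≠ 0 := fun H ↦ hc (by simp [G, H])
  set y : MvPolynomial (Fin n) F := (c 0)⁻¹ • h 0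
  set h' : Fin N → MvPolynomial (Fin n) F := fun i ↦ h i.succ - c i.succ • y
  set b := Ideal.span (Set.range h)
  set J := Ideal.span (Set.range h')
  have hb : ∀ i, h i ∈ b := fun i ↦ Ideal.subset_span ⟨i, rfl⟩
  have hsmul : ∀ (a : F) {x : MvPolynomial (Fin n) F}, x ∈ b → a • x ∈ b := fun a x hx ↦
    Submodule.smul_of_tower_mem b a hx
  have hy : y ∈ b := hsmul _ (hb 0)
  have hJb : J ≤ b := Ideal.span_le.mpr fun x ⟨i, hi⟩ ↦
    hi ▸ sub_mem (hb _) (hsmul _ hy)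
  have hdiff : ∀ i, h i - c i • y ∈ J := fun i ↦ by
    cases i using Fin.cases with
    | zero => simp [y, smul_smul, hc0]
    | succ i => exact Ideal.subset_span ⟨i, rfl⟩
  have hbJ : b = J ⊔ Ideal.span {y} := by
    refine le_antisymm (Ideal.span_le.mpr ?_)
      (sup_le hJb ((Ideal.span_singleton_le_iff_mem _).mpr hy))
    rintro _ ⟨i, rfl⟩
    rw [← sub_add_cancel (h i) (c i • y)]
    exact add_mem (Ideal.mem_sup_left (hdiff i)) (Ideal.mem_sup_right
      (Submodule.smul_of_tower_mem _ (c i) (Ideal.mem_span_singleton_self y)))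
  have hyd : y ^ (d + 1) ∈ J * b ^ d := by
    have h₁ := hG.aeval_sub_aeval_mem (K := F) hb (fun i ↦ hsmul (c i) hy) hdiff
    have h₂ : aeval h G = 0 := by rw [map_mul, hGh, zero_mul]
    have h₃ : aeval (fun i ↦ c i • y) G = eval c G • y ^ (d + 1) := by
      rw [aeval_def, eval₂_eq, eval_eq, Finset.sum_smul]
      refine Finset.sum_congr rfl fun α hα ↦ ?_
      have hdeg : Finsupp.weight (fun _ ↦ 1) α = d + 1 := hG (mem_support_iff.mp hα)
      rw [← Finsupp.degree_eq_weight_one, Finsupp.degree_apply] at hdeg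
      simp only [Algebra.smul_def, mul_pow, Finset.prod_mul_distrib,
        Finset.prod_pow_eq_pow_sum, hdeg, map_mul, map_prod, map_pow, mul_assoc]
    rw [h₂, h₃, zero_sub, neg_mem_iff] at h₁
    have h₄ := Submodule.smul_of_tower_mem _ (eval c G)⁻¹ h₁
    rwa [smul_smul, inv_mul_cancel₀ hc, one_smul] at h₄
  have hred : b ^ (d + 1) ≤ J * b ^ d := by
    have := Ideal.sup_span_singleton_pow_succ_le J y d
    rw [← hbJ] at this
    exact this.trans (sup_le le_rfl ((Ideal.span_singleton_le_iff_mem _).mpr hyd))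
  refine ⟨h', d, hJb, fun j ↦ ?_⟩
  have : b ^ (j + d) ≤ J ^ j * b ^ d := by
    induction j with
    | zero => simp
    | succ j ih =>
      calc b ^ (j + 1 + d) = b * b ^ (j + d) := by rw [← pow_succ']; congr 1; ring
        _ ≤ b * (J ^ j * b ^ d) := Ideal.mul_mono_right ih
        _ = J ^ j * b ^ (d + 1) := by ring
        _ ≤ J ^ j * (J * b ^ d) := Ideal.mul_mono_right hred
        _ = J ^ (j + 1) * b ^ d := by ring
  exact this.trans Ideal.mul_le_left

theorem MvPolynomial.exists_reduction {F : Type*} [Field F] [Infinite F] {n : ℕ}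
    (b : Ideal (MvPolynomial (Fin n) F)) :
    ∃ (h : Fin (n + 1) → MvPolynomial (Fin n) F) (s : ℕ),
      Ideal.span (Set.range h) ≤ b ∧ ∀ j, b ^ (j + s) ≤ Ideal.span (Set.range h) ^ j := by
  have key : ∀ (e : ℕ) (h : Fin (n + 1 + e) → MvPolynomial (Fin n) F),
      ∃ (h' : Fin (n + 1) → MvPolynomial (Fin n) F) (s : ℕ),
        Ideal.span (Set.range h') ≤ Ideal.span (Set.range h) ∧
        ∀ j, Ideal.span (Set.range h) ^ (j + s) ≤ Ideal.span (Set.range h') ^ j := by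
    intro e
    induction e with
    | zero => exact fun h ↦ ⟨h, 0, le_rfl, fun j ↦ le_rfl⟩
    | succ e ih =>
      intro h
      obtain ⟨h₁, s₁, hle₁, hs₁⟩ := exists_reduction_succ (N := n + 1 + e) (by omega) h
      obtain ⟨h₂, s₂, hle₂, hs₂⟩ := ih h₁
      refine ⟨h₂, s₂ + s₁, hle₂.trans hle₁, fun j ↦ ?_⟩
      exact ((Ideal.pow_le_pow_right (by omega)).trans (hs₁ (j + s₂))).trans (hs₂ j)
  obtain ⟨N, g, hg⟩ := Submodule.fg_iff_exists_fin_generating_family.mp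
    (IsNoetherian.noetherian b)
  have hspan : Ideal.span (Set.range (Fin.append (0 : Fin (n + 1) → _) g)) = b := by
    refine le_antisymm (Ideal.span_le.mpr ?_) ?_
    · rintro _ ⟨i, rfl⟩
      cases i using Fin.addCases with
      | left i => simp
      | right i =>
        rw [Fin.append_right, ← hg]
        exact Submodule.subset_span ⟨i, rfl⟩
    · rw [← hg]
      refine Submodule.span_mono ?_
      rintro _ ⟨i, rfl⟩
      exact ⟨Fin.natAdd _ i, Fin.append_right _ _ _⟩
  simpa only [hspan] using key N (Fin.append 0 g)

/-- A high power of an ideal with `r` generators is contained in the ideal generated by the `q`-th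
powers of the elements of a power of that ideal. -/
theorem Ideal.span_range_pow_le_span_pow {R : Type*} [CommRing R] {r : ℕ} (h : Fin r → R)
    {q M N : ℕ} (hq : 0 < q) (hN : q * M + r * (q - 1) < N + q) :
    span (Set.range h) ^ N ≤ span ((· ^ q) '' (span (Set.range h) ^ M : Ideal R)) := by
  intro x hx
  rw [mem_span_pow_iff_exists_isHomogeneous] at hx
  obtain ⟨P, hP, rfl⟩ := hx
  rw [eval_eq]
  refine Ideal.sum_mem _ fun α hα ↦ Ideal.mul_mem_left _ _ ?_
  have hdeg : ∑ i, α i = N := by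
    rw [← Finsupp.degree_eq_sum, ← hP (mem_support_iff.mp hα), Finsupp.degree_eq_weight_one]
    rfl
  have hprod : ∏ i ∈ α.support, h i ^ α i =
      (∏ i, h i ^ (α i % q)) * (∏ i, h i ^ (α i / q)) ^ q := by
    rw [← Finset.prod_pow, ← Finset.prod_mul_distrib]
    simp_rw [← pow_mul, ← pow_add, mul_comm _ q, Nat.mod_add_div]
    exact Finset.prod_subset (Finset.subset_univ _) fun i _ hi ↦ by
      rw [Finsupp.notMem_support_iff.mp hi, pow_zero]
  rw [hprod]
  refine Ideal.mul_mem_left _ _ (subset_span ⟨_, ?_, rfl⟩)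
  have hM : M ≤ ∑ i, α i / q := by
    have h₁ : ∑ i, α i % q ≤ r * (q - 1) := by
      simpa using Finset.sum_le_card_nsmul Finset.univ (fun i ↦ α i % q) (q - 1)
        fun i _ ↦ Nat.le_sub_one_of_lt (Nat.mod_lt _ hq)
    have h₂ : N = ∑ i, α i % q + q * ∑ i, α i / q := by
      rw [← hdeg, Finset.mul_sum, ← Finset.sum_add_distrib]
      exact Finset.sum_congr rfl fun i _ ↦ (Nat.mod_add_div _ _).symm
    by_contra! H
    have h₃ : q * (∑ i, α i / q + 1) ≤ q * M := Nat.mul_le_mul_left q H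
    rw [mul_add, mul_one] at h₃
    omega
  refine Ideal.pow_le_pow_right hM ?_
  rw [← Finset.prod_pow_eq_pow_sum]
  exact Ideal.prod_mem_prod fun i _ ↦ Ideal.pow_mem_pow (Ideal.subset_span (Set.mem_range_self i)) _

theorem MvPolynomial.pderiv_mul_mem_pow_of_charP {F : Type*} [Field F] [Infinite F] (p : ℕ)
    [hp : Fact p.Prime] [CharP F p] [PerfectRing F p] {n : ℕ} {b : Ideal (MvPolynomial (Fin n) F)}
    {f g : MvPolynomial (Fin n) F} {m : ℕ} (hfg : f * g ∈ b ^ m) (i : Fin n) :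
    pderiv i f * g ∈ b ^ (m - (n + 1)) := by
  obtain hm | hm := le_or_gt m (n + 1)
  · simp [Nat.sub_eq_zero_of_le hm]
  obtain ⟨h, s, hle, hs⟩ := exists_reduction b
  set J := Ideal.span (Set.range h)
  set e := m + s
  have hq : m + s < p ^ e := Nat.lt_pow_self hp.out.one_lt
  obtain ⟨Q, hQ⟩ : ∃ Q, p ^ e = Q + 1 := Nat.exists_eq_succ_of_ne_zero (by omega)
  obtain ⟨M, rfl⟩ : ∃ M, m = M + (n + 1) := ⟨m - (n + 1), by omega⟩
  rw [Nat.add_sub_cancel]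
  set m := M + (n + 1)
  have hsQ : s ≤ m * Q := by nlinarith
  have h₁ : f ^ Q * g ^ Q ∈ J ^ (m * Q - s) := by
    apply hs
    rw [Nat.sub_add_cancel hsQ, pow_mul, ← mul_pow]
    exact Ideal.pow_mem_pow hfg Q
  have h₂ : g ^ p ^ e * (f ^ (p ^ e - 1) * pderiv i f) ∈
      Ideal.span ((· ^ p ^ e) '' (J ^ M : Ideal _)) := by
    refine Ideal.span_range_pow_le_span_pow h (N := m * Q - s) (by omega) ?_ ?_
    · rw [hQ, Nat.add_sub_cancel]
      zify [hsQ]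
      simp only [m]
      push_cast
      have : (m : ℤ) + s < Q + 1 := by exact_mod_cast hQ ▸ hq
      simp only [m] at this
      push_cast at this
      nlinarith
    · have : g ^ p ^ e * (f ^ (p ^ e - 1) * pderiv i f) = (g * pderiv i f) * (f ^ Q * g ^ Q) := by
        rw [hQ, Nat.add_sub_cancel]
        ring
      rw [this]
      exact Ideal.mul_mem_left _ _ h₁
  have h₃ : ∀ x ∈ Ideal.span ((· ^ p ^ e) '' (J ^ M : Ideal (MvPolynomial (Fin n) F))),
      ∀ r, (cartier p i)^[e] (x * r) ∈ J ^ M := by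
    intro x hx
    induction hx using Submodule.span_induction with
    | mem x hx =>
      obtain ⟨a, ha, rfl⟩ := hx
      intro r
      rw [cartier_iterate_pow_mul]
      exact Ideal.mul_mem_right _ _ ha
    | zero => intro r; rw [zero_mul, iterate_map_zero]; exact zero_mem _
    | add x y _ _ hx hy =>
      intro r
      rw [add_mul, iterate_map_add]
      exact add_mem (hx r) (hy r)
    | smul a x _ hx =>
      intro r
      rw [smul_eq_mul, mul_comm a, mul_assoc]
      exact hx _
  have h₄ := h₃ _ h₂ 1
  rw [mul_one, cartier_iterate_pow_mul, cartier_iterate_pow_mul_pderiv, mul_comm] at h₄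
  exact Ideal.pow_right_mono hle M h₄

theorem Int.isJacobsonRing : IsJacobsonRing ℤ := by
  rw [isJacobsonRing_iff_prime_eq]
  intro P hP
  by_cases h0 : P = ⊥
  · subst h0
    refine le_antisymm (fun x hx ↦ ?_) Ideal.le_jacobson
    obtain ⟨p, hle, hp⟩ := Nat.exists_infinite_primes (x.natAbs + 1)
    have hmax : (Ideal.span {(p : ℤ)}).IsMaximal :=
      PrincipalIdealRing.isMaximal_of_irreducible (Nat.prime_iff_prime_int.mp hp).irreducible
    have hxp : x ∈ Ideal.span {(p : ℤ)} := Ideal.mem_sInf.mp hx ⟨bot_le, hmax⟩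
    rw [Ideal.mem_span_singleton, Int.natCast_dvd] at hxp
    rw [Ideal.mem_bot, ← Int.natAbs_eq_zero]
    exact Nat.eq_zero_of_dvd_of_lt hxp hle
  · have := hP.isMaximal h0
    exact Ideal.jacobson_eq_self_of_isMaximal

theorem exists_ringHom_algClosed_charP.{u} (A : Type u) [CommRing A] [Nontrivial A]
    [Algebra.FiniteType ℤ A] :
    ∃ (L : Type u) (_ : Field L) (_ : IsAlgClosed L) (p : ℕ) (_ : p.Prime) (_ : CharP L p),
      Nonempty (A →+* L) := by
  obtain ⟨M, hM⟩ := Ideal.exists_maximal A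
  let _ : Field (A ⧸ M) := Ideal.Quotient.field M
  obtain ⟨p, hp⟩ := CharP.exists (A ⧸ M)
  obtain hprime | rfl := CharP.char_is_prime_or_zero (A ⧸ M) p
  · exact ⟨AlgebraicClosure (A ⧸ M), inferInstance, inferInstance, p, hprime,
      charP_of_injective_algebraMap (algebraMap (A ⧸ M) _).injective p,
      ⟨(algebraMap (A ⧸ M) _).comp (Ideal.Quotient.mk M)⟩⟩
  · exfalso
    have : CharZero (A ⧸ M) := CharP.charP_to_charZero _
    have := Int.isJacobsonRing
    have : Module.Finite ℤ (A ⧸ M) := finite_of_finite_type_of_isJacobsonRing ℤ (A ⧸ M)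
    exact Int.not_isField (isField_of_isIntegral_of_isField
      (R := ℤ) (S := A ⧸ M) (RingHom.injective_int (algebraMap ℤ (A ⧸ M))) (Field.toIsField _))

theorem Ideal.exists_notMem_sup_pow_of_notMem {R : Type*} [CommRing R] [IsNoetherianRing R]
    {I : Ideal R} {u : R} (hu : u ∉ I) :
    ∃ (M : Ideal R) (t : ℕ), M.IsMaximal ∧ u ∉ I ⊔ M ^ t := by
  have hcolon : I.colon {u} ≠ ⊤ := by
    rw [Ideal.ne_top_iff_one, Submodule.mem_colon_singleton]
    simpa using hu
  obtain ⟨M, hM, hle⟩ := Ideal.exists_le_maximal _ hcolon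
  refine ⟨M, ?_⟩
  by_contra! H
  have hmem : Ideal.Quotient.mk I u ∈ (⨅ t : ℕ, M ^ t • ⊤ : Submodule R (R ⧸ I)) := by
    rw [Submodule.mem_iInf]
    intro t
    obtain ⟨x, hx, y, hy, hxy⟩ := Submodule.mem_sup.mp (H t hM)
    have : Ideal.Quotient.mk I u = y • (1 : R ⧸ I) := by
      rw [← hxy, map_add, Ideal.Quotient.eq_zero_iff_mem.mpr hx, zero_add, Algebra.smul_def,
        mul_one]
      rfl
    rw [this]
    exact Submodule.smul_mem_smul hy trivial
  obtain ⟨r, hr⟩ := (M.mem_iInf_smul_pow_eq_bot_iff _).mp hmem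
  have h1 : 1 - (r : R) ∈ M := hle <| by
    rw [Submodule.mem_colon_singleton, smul_eq_mul, ← Ideal.Quotient.eq_zero_iff_mem, sub_mul,
      map_sub, one_mul, sub_eq_zero]
    exact hr.symm
  exact hM.ne_top ((Ideal.eq_top_iff_one _).mpr (by simpa using add_mem h1 r.2))

/-- Over an algebraically closed field, nonmembership in an ideal of polynomials is witnessed by a
functional which vanishes on the ideal and whose values at all monomials lie in a ring of finite
type. -/
theorem MvPolynomial.exists_functional_of_notMem {k : Type*} [Field k] [IsAlgClosed k] {n : ℕ}
    {I : Ideal (MvPolynomial (Fin n) k)} {u : MvPolynomial (Fin n) k} (hu : u ∉ I) :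
    ∃ (l : MvPolynomial (Fin n) k →ₗ[k] k) (T : Set k), T.Finite ∧ (∀ x ∈ I, l x = 0) ∧ l u = 1 ∧
      ∀ A : Subalgebra ℤ k, T ⊆ A → ∀ α, l (monomial α 1) ∈ A := by
  obtain ⟨M, t, hM, huM⟩ := Ideal.exists_notMem_sup_pow_of_notMem hu
  obtain ⟨a, rfl⟩ := isMaximal_iff_eq_vanishingIdeal_singleton.mp hM
  set M := vanishingIdeal k {a}
  obtain ⟨l₀, hl₀, hker⟩ := Submodule.exists_le_ker_of_notMem
    (p := (I ⊔ M ^ t).restrictScalars k) (v := u) huM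
  set l := (l₀ u)⁻¹ • l₀
  have hl : ∀ x ∈ I ⊔ M ^ t, l x = 0 := fun x hx ↦ by
    have : l₀ x = 0 := hker hx
    simp [l, this]
  let W : (Fin n →₀ ℕ) → MvPolynomial (Fin n) k := fun β ↦ ∏ i, (X i - C (a i)) ^ β i
  have hXM : ∀ i, X i - C (a i) ∈ M := fun i ↦ by
    simp [M]
  have hW : ∀ β : Fin n →₀ ℕ, t ≤ β.degree → l (W β) = 0 := fun β hβ ↦ by
    refine hl _ (Ideal.mem_sup_right (Ideal.pow_le_pow_right hβ ?_))
    rw [Finsupp.degree_eq_sum, ← Finset.prod_pow_eq_pow_sum]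
    exact Ideal.prod_mem_prod fun i _ ↦ Ideal.pow_mem_pow (hXM i) _
  refine ⟨l, Set.range a ∪ (fun β ↦ l (W β)) '' {β | β.degree < t},
    (Set.finite_range a).union ((Finsupp.finite_of_degree_lt t).image _),
    fun x hx ↦ hl x (Ideal.mem_sup_left hx), by simp [l, hl₀], fun A hA α ↦ ?_⟩
  have haA : ∀ i, a i ∈ A := fun i ↦ hA (Or.inl ⟨i, rfl⟩)
  have hWA : ∀ β, l (W β) ∈ A := fun β ↦ by
    obtain h | h := lt_or_ge β.degree t
    · exact hA (Or.inr ⟨β, h, rfl⟩)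
    · rw [hW β h]
      exact zero_mem A
  have key : ∀ (P : MvPolynomial (Fin n) A) (β : Fin n →₀ ℕ),
      l (map (algebraMap A k) P * W β) ∈ A := by
    intro P
    induction P using MvPolynomial.induction_on with
    | C c =>
      intro β
      rw [map_C, C_mul', map_smul]
      exact mul_mem c.2 (hWA β)
    | add P Q hP hQ =>
      intro β
      rw [map_add, add_mul, map_add]
      exact add_mem (hP β) (hQ β)
    | mul_X P i hP =>
      intro β
      have hWs : W (β + Finsupp.single i 1) = (X i - C (a i)) * W β := by
        classical
        simp only [W, Finsupp.add_apply, pow_add, Finset.prod_mul_distrib, Finsupp.single_apply]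
        rw [mul_comm]
        congr 1
        simp
      have : map (algebraMap A k) (P * X i) * W β =
          map (algebraMap A k) P * W (β + Finsupp.single i 1) +
            a i • (map (algebraMap A k) P * W β) := by
        rw [hWs, map_mul, map_X, smul_eq_C_mul]
        ring
      rw [this, map_add, map_smul]
      exact add_mem (hP _) (mul_mem (haA i) (hP β))
  simpa [W, map_monomial] using key (monomial α 1) 0

theorem MvPolynomial.exists_finite_forall_subalgebra_mem_map {k σ : Type*} [Field k]
    {b : Ideal (MvPolynomial σ k)} {m : ℕ} {x : MvPolynomial σ k} (hx : x ∈ b ^ m) :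
    ∃ T : Set k, T.Finite ∧ ∀ A : Subalgebra ℤ k, T ⊆ A →
      ∃ y ∈ b.comap (map (algebraMap A k)) ^ m, map (algebraMap A k) y = x := by
  have lift (x : MvPolynomial σ k) : ∃ T : Set k, T.Finite ∧ ∀ A : Subalgebra ℤ k, T ⊆ A →
      ∃ y, map (algebraMap A k) y = x := by
    refine ⟨x.coeffs, x.coeffs.finite_toSet, fun A hA ↦ ?_⟩
    exact mem_range_map_iff_coeffs_subset.mpr fun c hc ↦ ⟨⟨c, hA hc⟩, rfl⟩
  induction m generalizing x with
  | zero =>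
    obtain ⟨T, hT, h⟩ := lift x
    refine ⟨T, hT, fun A hA ↦ ?_⟩
    obtain ⟨y, hy⟩ := h A hA
    exact ⟨y, by simp, hy⟩
  | succ m ih =>
    rw [pow_succ] at hx
    induction hx using Submodule.mul_induction_on' with
    | mem_mul_mem x hx z hz =>
      obtain ⟨T, hT, h⟩ := ih hx
      obtain ⟨T', hT', h'⟩ := lift z
      refine ⟨T ∪ T', hT.union hT', fun A hA ↦ ?_⟩
      obtain ⟨y, hy, rfl⟩ := h A (Set.subset_union_left.trans hA)
      obtain ⟨y', rfl⟩ := h' A (Set.subset_union_right.trans hA)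
      exact ⟨y * y', pow_succ (b.comap (map (algebraMap A k))) m ▸ Ideal.mul_mem_mul hy hz,
        map_mul ..⟩
    | add x _ z _ hx hz =>
      obtain ⟨T, hT, h⟩ := hx
      obtain ⟨T', hT', h'⟩ := hz
      refine ⟨T ∪ T', hT.union hT', fun A hA ↦ ?_⟩
      obtain ⟨y, hy, rfl⟩ := h A (Set.subset_union_left.trans hA)
      obtain ⟨y', hy', rfl⟩ := h' A (Set.subset_union_right.trans hA)
      exact ⟨y + y', add_mem hy hy', map_add ..⟩

theorem MvPolynomial.constr_basisMonomials_monomial {σ A : Type*} [CommRing A]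
    (w : (σ →₀ ℕ) → A) (α : σ →₀ ℕ) (c : A) :
    (basisMonomials σ A).constr A w (monomial α c) = c * w α := by
  have := (basisMonomials σ A).constr_basis A w α
  rw [coe_basisMonomials] at this
  rw [← mul_one c, ← smul_eq_mul, ← smul_monomial, map_smul, this]
  simp

theorem MvPolynomial.constr_basisMonomials_map {σ A B : Type*} [CommRing A] [CommRing B]
    (θ : A →+* B) (w : (σ →₀ ℕ) → A) (P : MvPolynomial σ A) :
    (basisMonomials σ B).constr B (fun α ↦ θ (w α)) (map θ P) =
      θ ((basisMonomials σ A).constr A w P) := by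
  induction P using MvPolynomial.induction_on' with
  | monomial α c => simp only [map_monomial, constr_basisMonomials_monomial, map_mul]
  | add P Q hP hQ => simp only [map_add, hP, hQ]

/-- A functional vanishing on an ideal of polynomials still vanishes on its extension after a
change of coefficient rings. -/
theorem MvPolynomial.constr_basisMonomials_eq_zero_of_mem_map {σ A B : Type*} [CommRing A]
    [CommRing B] (θ : A →+* B) (w : (σ →₀ ℕ) → A) {I : Ideal (MvPolynomial σ A)}
    (hI : ∀ x ∈ I, (basisMonomials σ A).constr A w x = 0) {x : MvPolynomial σ B}
    (hx : x ∈ I.map (map θ)) : (basisMonomials σ B).constr B (fun α ↦ θ (w α)) x = 0 := by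
  suffices ∀ a, (basisMonomials σ B).constr B (fun α ↦ θ (w α)) (a * x) = 0 by
    simpa using this 1
  rw [Ideal.map] at hx
  induction hx using Submodule.span_induction with
  | zero => simp
  | add x y _ _ hx hy =>
    intro a
    rw [mul_add, map_add, hx, hy, add_zero]
  | mem x hx =>
    intro a
    obtain ⟨y, hy, rfl⟩ := hx
    induction a using MvPolynomial.induction_on' with
    | monomial α c =>
      have : monomial α c * map θ y = c • map θ (monomial α 1 * y) := by
        rw [map_mul, map_monomial, map_one, ← smul_mul_assoc, smul_monomial, smul_eq_mul, mul_one]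
      rw [this, map_smul, constr_basisMonomials_map, hI _ (I.mul_mem_left _ hy), map_zero,
        smul_zero]
    | add P Q hP hQ => rw [add_mul, map_add, hP, hQ, add_zero]
  | smul a x _ hx =>
    intro r
    rw [smul_eq_mul, ← mul_assoc]
    exact hx _

/-- Differentiating one factor of an element of `b ^ m` costs at most `n + 1` powers of `b`,
whatever the ideal `b`. -/
theorem MvPolynomial.pderiv_mul_mem_pow {k : Type*} [Field k] [IsAlgClosed k] [CharZero k] {n : ℕ}
    {b : Ideal (MvPolynomial (Fin n) k)} {f g : MvPolynomial (Fin n) k} {m : ℕ}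
    (hfg : f * g ∈ b ^ m) (i : Fin n) : pderiv i f * g ∈ b ^ (m - (n + 1)) := by
  by_contra hu
  obtain ⟨l, T₁, hT₁, hl, hlu, hlA⟩ := exists_functional_of_notMem hu
  obtain ⟨T₂, hT₂, h₂⟩ := exists_finite_forall_subalgebra_mem_map hfg
  obtain ⟨T₃, hT₃, h₃⟩ := exists_finite_forall_subalgebra_mem_map (b := ⊤) (m := 0)
    (x := f) (by simp)
  obtain ⟨T₄, hT₄, h₄⟩ := exists_finite_forall_subalgebra_mem_map (b := ⊤) (m := 0)
    (x := g) (by simp)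
  have hT := ((hT₁.union hT₂).union hT₃).union hT₄
  set A := Algebra.adjoin ℤ (T₁ ∪ T₂ ∪ T₃ ∪ T₄) with hA
  have hTA : T₁ ∪ T₂ ∪ T₃ ∪ T₄ ⊆ A := Algebra.subset_adjoin
  simp only [Set.union_subset_iff] at hTA
  obtain ⟨⟨⟨hA₁, hA₂⟩, hA₃⟩, hA₄⟩ := hTA
  have : Algebra.FiniteType ℤ A :=
    A.fg_iff_finiteType.mp ⟨hT.toFinset, by rw [hT.coe_toFinset]⟩
  obtain ⟨F, -, rfl⟩ := h₃ A hA₃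
  obtain ⟨G, -, rfl⟩ := h₄ A hA₄
  obtain ⟨y, hy, hyFG⟩ := h₂ A hA₂
  have hinj : Function.Injective (map (σ := Fin n) (algebraMap A k)) :=
    map_injective _ Subtype.val_injective
  obtain rfl : y = F * G := hinj (by rw [hyFG, map_mul])
  set c := b.comap (map (algebraMap A k))
  let w : (Fin n →₀ ℕ) → A := fun α ↦ ⟨l (monomial α 1), hlA A hA₁ α⟩
  have hlw (P : MvPolynomial (Fin n) A) :
      algebraMap A k ((basisMonomials (Fin n) A).constr A w P) = l (map (algebraMap A k) P) := by
    rw [← constr_basisMonomials_map]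
    congr 1
    exact (basisMonomials (Fin n) k).constr_eq k fun α ↦ by simp [w]
  have hw : ∀ x ∈ c ^ (m - (n + 1)), (basisMonomials (Fin n) A).constr A w x = 0 := by
    intro x hx
    apply Subtype.val_injective
    refine (hlw x).trans (hl _ ?_)
    exact Ideal.le_comap_pow _ _ hx
  have hw1 : (basisMonomials (Fin n) A).constr A w (pderiv i F * G) = 1 := by
    apply Subtype.val_injective
    refine (hlw _).trans ?_
    rw [map_mul, ← pderiv_map]
    exact hlu
  obtain ⟨L, _, _, p, hp, _, ⟨ψ⟩⟩ := exists_ringHom_algClosed_charP A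
  have : Fact p.Prime := ⟨hp⟩
  have hψ : map ψ F * map ψ G ∈ (c.map (map ψ)) ^ m := by
    rw [← map_mul, ← Ideal.map_pow]
    exact Ideal.mem_map_of_mem _ hy
  have key := pderiv_mul_mem_pow_of_charP p hψ i
  rw [← Ideal.map_pow, pderiv_map, ← map_mul] at key
  have h0 := constr_basisMonomials_eq_zero_of_mem_map ψ w hw key
  rw [constr_basisMonomials_map, hw1, map_one] at h0
  exact one_ne_zero h0

theorem MvPolynomial.eq_C_of_pderiv_eq_zero {R σ : Type*} [CommRing R] [IsDomain R] [CharZero R]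
    {f : MvPolynomial σ R} (hf : ∀ i, pderiv i f = 0) : f = C (coeff 0 f) := by
  classical
  ext α
  rw [coeff_C]
  split_ifs with h
  · rw [h]
  · obtain ⟨i, hi⟩ : ∃ i, α i ≠ 0 := by
      by_contra! H
      exact h (Finsupp.ext fun i ↦ (H i).symm)
    have := congrArg (coeff (α - Finsupp.single i 1)) (hf i)
    rw [coeff_pderiv, tsub_add_cancel_of_le (by simpa [Nat.one_le_iff_ne_zero] using hi),
      coeff_zero] at this
    refine (mul_eq_zero.mp this).resolve_right ?_
    exact Nat.cast_add_one_ne_zero _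

theorem MvPolynomial.totalDegree_pderiv_lt {R σ : Type*} [CommRing R] {f : MvPolynomial σ R}
    {i : σ} (hf : pderiv i f ≠ 0) : (pderiv i f).totalDegree < f.totalDegree := by
  obtain ⟨α, hα, hdeg⟩ := Finset.exists_mem_eq_sup _ (support_nonempty.mpr hf)
    fun s ↦ s.sum fun _ e ↦ e
  have hα' : α + Finsupp.single i 1 ∈ f.support := by
    rw [mem_support_iff, coeff_pderiv] at hα
    exact mem_support_iff.mpr (left_ne_zero_of_mul hα)
  have hle := le_totalDegree hα'
  rw [Finsupp.sum_add_index' (fun _ ↦ rfl) (fun _ _ _ ↦ rfl), Finsupp.sum_single_index rfl] at hle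
  rw [totalDegree, hdeg]
  exact hle

theorem MvPolynomial.exists_mem_pow_of_mul_mem_pow {k : Type*} [Field k] [IsAlgClosed k]
    [CharZero k] {n : ℕ} {f : MvPolynomial (Fin n) k} (hf : f ≠ 0) :
    ∃ k₀ : ℕ, ∀ (b : Ideal (MvPolynomial (Fin n) k)) (m : ℕ) (g : MvPolynomial (Fin n) k),
      f * g ∈ b ^ m → g ∈ b ^ (m - k₀) := by
  induction hd : f.totalDegree using Nat.strong_induction_on generalizing f with
  | _ d ih =>
    subst hd
    by_cases h : ∀ i, pderiv i f = 0
    · refine ⟨0, fun b m g hg ↦ ?_⟩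
      have hC := eq_C_of_pderiv_eq_zero h
      have h0 : coeff 0 f ≠ 0 := fun h0 ↦ hf (by rw [hC, h0, C_0])
      have := (b ^ m).mul_mem_left (C (coeff 0 f)⁻¹) hg
      rwa [hC, ← mul_assoc, ← C_mul, coeff_C, if_pos rfl, inv_mul_cancel₀ h0, C_1, one_mul] at this
    · push Not at h
      obtain ⟨i, hi⟩ := h
      obtain ⟨k₀, hk₀⟩ := ih _ (totalDegree_pderiv_lt hi) hi rfl
      refine ⟨n + 1 + k₀, fun b m g hg ↦ ?_⟩
      rw [← Nat.sub_sub]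
      exact hk₀ b _ g (pderiv_mul_mem_pow hg i)

/-- (Huneke's uniform Artin–Rees theorem, polynomial ring case) For every nonzero
`f ∈ k[x_1,…,x_n]` there is an integer `k_0`, depending only on `f`, such that for every
ideal `𝔟` and every `m ≥ k_0` one has `𝔟^m ∩ (f) ⊆ 𝔟^{m-k_0}·(f)`. -/
theorem uniformArtinRees_exists {k : Type*} [Field k] [IsAlgClosed k] [CharZero k] {n : ℕ}
    (f : MvPolynomial (Fin n) k) (hf : f ≠ 0) :
    ∃ k0 : ℕ, ∀ (b : Ideal (MvPolynomial (Fin n) k)) (m : ℕ), k0 ≤ m →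
      b ^ m ⊓ Ideal.span {f} ≤ b ^ (m - k0) * Ideal.span {f} := by
  obtain ⟨k₀, hk₀⟩ := MvPolynomial.exists_mem_pow_of_mul_mem_pow hf
  refine ⟨k₀, fun b m _ x ⟨hx, hxf⟩ ↦ ?_⟩
  obtain ⟨g, rfl⟩ := Ideal.mem_span_singleton.mp hxf
  rw [mul_comm f g]
  exact Ideal.mul_mem_mul (hk₀ b m g hx) (Ideal.mem_span_singleton_self f)
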